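/- arXiv:1212.1298 — 2 statements merged into one kernel-verified Lean document; each statement's English description precedes it below -/
import Mathlib

section
/- Let k ≥ 2. The map from the dicyclic (generalized quaternion) group QuaternionGroup (2^{k-1}) of order 2^{k+1} to the dihedral group DihedralGroup (2^k) sending a^i (the element a i) to the rotation r^i and sending a^i·x (the element xa i) to the reflection s·r^i, for i ∈ ZMod (2^k), is a subgroup-preserving bijection. -/
/-- The map from the dicyclic (generalized quaternion) group of order `2 ^ (k+1)` to the
dihedral group of order `2 ^ (k+1)`, sending `a i` to the rotation `r i` and `xa i` to the
reflection `sr i`. -/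
def quaternionToDihedral (k : ℕ) :
    QuaternionGroup (2 ^ (k - 1)) → DihedralGroup (2 ^ k)
  | QuaternionGroup.a i => DihedralGroup.r (i.val : ZMod (2 ^ k))
  | QuaternionGroup.xa i => DihedralGroup.sr (i.val : ZMod (2 ^ k))

namespace QuaternionGroup

variable {n m : ℕ}

theorem a_sub_mem_of_xa_mem {K : Subgroup (QuaternionGroup n)} {i j : ZMod (2 * n)}
    (hi : xa i ∈ K) (hj : xa j ∈ K) : a (j - i) ∈ K := by
  have h := K.mul_mem (K.mul_mem hi hi) (K.mul_mem hi hj)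
  have h2 : (n : ZMod (2 * n)) + n = 0 := by
    rw [← Nat.cast_add, ← two_mul, ZMod.natCast_self]
  simp only [xa_mul_xa, a_mul_a] at h
  convert h using 2
  linear_combination -h2

theorem exists_subgroup_coe_eq_image (e : ZMod (2 * n) →+ ZMod m)
    (f : QuaternionGroup n → DihedralGroup m) (ha : ∀ i, f (a i) = DihedralGroup.r (e i))
    (hxa : ∀ i, f (xa i) = DihedralGroup.sr (e i)) (K : Subgroup (QuaternionGroup n)) :
    ∃ L : Subgroup (DihedralGroup m), (L : Set (DihedralGroup m)) = f '' K := by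
  refine ⟨{ carrier := f '' K, mul_mem' := ?_, one_mem' := ?_, inv_mem' := ?_ }, rfl⟩
  · rintro _ _ ⟨i | i, hi, rfl⟩ ⟨j | j, hj, rfl⟩
    · exact ⟨a (i + j), K.mul_mem hi hj, by simp [ha]⟩
    · exact ⟨xa (j - i), K.mul_mem hi hj, by simp [ha, hxa]⟩
    · exact ⟨xa (i + j), K.mul_mem hi hj, by simp [ha, hxa]⟩
    · exact ⟨a (j - i), a_sub_mem_of_xa_mem hi hj, by simp [ha, hxa]⟩
  · exact ⟨a 0, K.one_mem, by simp only [ha, map_zero, DihedralGroup.one_def]⟩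
  · rintro _ ⟨i | i, hi, rfl⟩
    · exact ⟨a (-i), K.inv_mem hi, by simp [ha]⟩
    · exact ⟨xa i, hi, by simp [hxa]⟩

theorem bijective_of_map_a_of_map_xa (e : ZMod (2 * n) ≃ ZMod m)
    (f : QuaternionGroup n → DihedralGroup m) (ha : ∀ i, f (a i) = DihedralGroup.r (e i))
    (hxa : ∀ i, f (xa i) = DihedralGroup.sr (e i)) : Function.Bijective f := by
  constructor
  · rintro (i | i) (j | j) h <;> simp_all
  · rintro (i | i)
    · exact ⟨a (e.symm i), by simp [ha]⟩
    · exact ⟨xa (e.symm i), by simp [hxa]⟩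

end QuaternionGroup

theorem ZMod.ringEquivCongr_eq_natCast_val {m n : ℕ} [NeZero m] (h : m = n) (i : ZMod m) :
    ZMod.ringEquivCongr h i = (i.val : ZMod n) := by
  conv_lhs => rw [← ZMod.natCast_zmod_val i]
  exact map_natCast _ _

theorem stmt_9 (k : ℕ) (hk : 2 ≤ k) :
    Function.Bijective (quaternionToDihedral k) ∧
    ∀ K : Subgroup (QuaternionGroup (2 ^ (k - 1))),
      ∃ L : Subgroup (DihedralGroup (2 ^ k)),
        (L : Set (DihedralGroup (2 ^ k))) =
          quaternionToDihedral k '' (K : Set (QuaternionGroup (2 ^ (k - 1)))) := by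
  have h : 2 * 2 ^ (k - 1) = 2 ^ k := mul_pow_sub_one (by lia) 2
  let e := ZMod.ringEquivCongr h
  have ha (i : ZMod (2 * 2 ^ (k - 1))) :
      quaternionToDihedral k (.a i) = .r (e i) :=
    congrArg _ (ZMod.ringEquivCongr_eq_natCast_val h i).symm
  have hxa (i : ZMod (2 * 2 ^ (k - 1))) :
      quaternionToDihedral k (.xa i) = .sr (e i) :=
    congrArg _ (ZMod.ringEquivCongr_eq_natCast_val h i).symm
  exact ⟨QuaternionGroup.bijective_of_map_a_of_map_xa e.toEquiv _ ha hxa,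
    QuaternionGroup.exists_subgroup_coe_eq_image e.toAddEquiv.toAddMonoidHom _ ha hxa⟩
end

section
/- Let p be a prime and let G be a non-abelian group of order p^3. Then G is uniformly abelian group representable for n = 3 via the group A = ZMod (p^2) × ZMod p: for every choice of subgroups G_1, G_2, G_3 of G there exist subgroups A_1, A_2, A_3 of A such that for every nonempty subset 𝒜 ⊆ {1, 2, 3}, the index [G : ⋂_{i∈𝒜} G_i] equals [A : ⋂_{i∈𝒜} A_i]. -/
/-- The meet operation on the eight-element lattice `⊥, Φ, Q₁, Q₂, Ω, N₁, N₂, ⊤` (in this order),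
where `Φ, Q₁, Q₂ ≤ Ω` and `Φ ≤ N₁, N₂`. -/
def modelMeet (i j : Fin 8) : Fin 8 :=
  if i = j then i
  else if i = 7 then j
  else if j = 7 then i
  else if i = 4 ∧ (j = 1 ∨ j = 2 ∨ j = 3) then j
  else if j = 4 ∧ (i = 1 ∨ i = 2 ∨ i = 3) then i
  else if (i = 1 ∨ 4 ≤ i) ∧ (j = 1 ∨ 4 ≤ j) then 1
  else 0

/-- The rank function of the eight-element lattice on which `modelMeet` is defined. -/
def modelRank (i : Fin 8) : Fin 4 :=
  if i = 0 then 0 else if i ≤ 3 then 1 else if i ≤ 6 then 2 else 3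

/-- The constraints on the rank `x` of the meet of two elements of ranks `a` and `b`. -/
def MeetRank (a b x : Fin 4) : Prop :=
  x ≤ a ∧ x ≤ b ∧ (a = 3 → x = b) ∧ (b = 3 → x = a) ∧ (a = 2 → b = 2 → 1 ≤ x)

instance (a b x : Fin 4) : Decidable (MeetRank a b x) := by
  unfold MeetRank
  infer_instance

theorem exists_model_of_ranks :
    ∀ a b x : Fin 4, MeetRank a b x → ∀ c y : Fin 4, MeetRank a c y →
    ∀ z : Fin 4, MeetRank b c z →
      (x = a → x = b → y = z) → (y = a → y = c → x = z) → (z = b → z = c → x = y) →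
    ∃ i, modelRank i = a ∧ ∃ j, modelRank j = b ∧ modelRank (modelMeet i j) = x ∧
      ∃ k, modelRank k = c ∧ modelRank (modelMeet i k) = y ∧ modelRank (modelMeet j k) = z ∧
        modelRank (modelMeet (modelMeet i j) k) = min x (min y z) := by
  decide +kernel

theorem AddSubgroup.natCard_prod {A B : Type*} [AddGroup A] [AddGroup B] (H : AddSubgroup A)
    (K : AddSubgroup B) : Nat.card (H.prod K) = Nat.card H * Nat.card K :=
  (Nat.card_congr (H.prodEquiv K).toEquiv).trans (Nat.card_prod _ _)

theorem AddMonoidHom.natCard_range_of_injective {A B : Type*} [AddGroup A] [AddGroup B]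
    {f : A →+ B} (hf : Function.Injective f) : Nat.card f.range = Nat.card A :=
  (Nat.card_congr (AddMonoidHom.ofInjective hf).toEquiv).symm

/-- A realization of the eight-element lattice by subgroups of `ZMod (p ^ 2) × ZMod p`. -/
theorem exists_model_subgroups (p : ℕ) (hp : p.Prime) :
    ∃ f : Fin 8 → AddSubgroup (ZMod (p ^ 2) × ZMod p),
      (∀ i j, f i ⊓ f j = f (modelMeet i j)) ∧
      ∀ i, Nat.card (f i) = p ^ (modelRank i : ℕ) := by
  have : Fact p.Prime := ⟨hp⟩
  let π : ZMod (p ^ 2) →+ ZMod p :=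
    (ZMod.castHom (dvd_pow_self p two_ne_zero) (ZMod p)).toAddMonoidHom
  have hπ : Function.Surjective π := ZMod.castHom_surjective (dvd_pow_self p two_ne_zero)
  have hker : Nat.card π.ker = p := by
    have h := π.ker.card_mul_index
    rw [AddSubgroup.index_ker, π.range_eq_top_of_surjective hπ] at h
    simp only [AddSubgroup.card_top, Nat.card_zmod, sq] at h
    exact Nat.eq_of_mul_eq_mul_right hp.pos h
  obtain ⟨ι, hι, hπι⟩ : ∃ ι : ZMod p →+ ZMod (p ^ 2),
      Function.Injective ι ∧ ∀ y, π (ι y) = 0 := by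
    let e : ZMod p ≃+ π.ker := addEquivOfPrimeCardEq (p := p) (Nat.card_zmod p) hker
    exact ⟨π.ker.subtype.comp e.toAddMonoidHom,
      Subtype.val_injective.comp e.injective, fun y => (e y).2⟩
  have hι0 (y) : ι y = 0 ↔ y = 0 := map_eq_zero_iff ι hι
  clear_value π
  refine ⟨![⊥, π.ker.prod ⊥, (⊥ : AddSubgroup _).prod ⊤, (ι.prod (AddMonoidHom.id _)).range,
    π.ker.prod ⊤, (⊤ : AddSubgroup _).prod ⊥, ((AddMonoidHom.id _).prod π).range, ⊤],
    fun i j => ?_, fun i => ?_⟩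
  · fin_cases i <;> fin_cases j <;> ext ⟨u, v⟩ <;>
      simp [modelMeet, AddSubgroup.mem_prod, AddMonoidHom.mem_ker] <;> grind
  · fin_cases i
    · simp [modelRank]
    · exact (AddSubgroup.natCard_prod _ _).trans (by rw [hker]; simp [modelRank])
    · exact (AddSubgroup.natCard_prod _ _).trans (by simp [modelRank])
    · exact (AddMonoidHom.natCard_range_of_injective fun _ _ h => congrArg Prod.snd h).trans
        (by simp [modelRank])
    · exact (AddSubgroup.natCard_prod _ _).trans (by rw [hker]; simp [modelRank, sq])
    · exact (AddSubgroup.natCard_prod _ _).trans (by simp [modelRank])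
    · exact (AddMonoidHom.natCard_range_of_injective fun _ _ h => congrArg Prod.fst h).trans
        (by simp [modelRank])
    · exact AddSubgroup.card_top.trans (by simp [modelRank, pow_succ])

open scoped commutatorElement in
theorem Subgroup.commutatorElement_mem_of_index_eq_prime {G : Type*} [Group G] {p n : ℕ}
    (hp : p.Prime) (hn : n ≠ 0) (hG : Nat.card G = p ^ n) {M : Subgroup G} (hM : M.index = p)
    (x y : G) : ⁅x, y⁆ ∈ M := by
  have hmin : M.index = (Nat.card G).minFac := by rw [hM, hG, hp.pow_minFac hn]
  have := M.normal_of_index_eq_minFac_card hmin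
  have : Fact p.Prime := ⟨hp⟩
  have : IsCyclic (G ⧸ M) := isCyclic_of_prime_card (p := p) hM
  rw [← QuotientGroup.eq_one_iff]
  have := commutatorElement_eq_one_iff_mul_comm.2 (mul_comm' (x : G ⧸ M) y)
  exact this

open scoped commutatorElement in
theorem exists_ne_one_mem_of_index_eq_prime {G : Type*} [Group G] {p n : ℕ} (hp : p.Prime)
    (hn : n ≠ 0) (hG : Nat.card G = p ^ n) (hna : ∃ x y : G, x * y ≠ y * x) :
    ∃ g : G, g ≠ 1 ∧ ∀ M : Subgroup G, M.index = p → g ∈ M := by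
  obtain ⟨x, y, hxy⟩ := hna
  exact ⟨⁅x, y⁆, mt commutatorElement_eq_one_iff_mul_comm.1 hxy,
    fun _ hM => Subgroup.commutatorElement_mem_of_index_eq_prime hp hn hG hM x y⟩

theorem exists_log_card {G : Type*} [Group G] {p n : ℕ} (hp : p.Prime)
    (hG : Nat.card G = p ^ n) :
    ∃ e : Subgroup G → Fin (n + 1), ∀ H : Subgroup G, Nat.card H = p ^ (e H : ℕ) := by
  have h (H : Subgroup G) : ∃ k : Fin (n + 1), Nat.card H = p ^ (k : ℕ) := by
    obtain ⟨k, hk, h⟩ := (Nat.dvd_prime_pow hp).1 (hG ▸ H.card_subgroup_dvd_card)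
    exact ⟨⟨k, by omega⟩, h⟩
  choose e he using h
  exact ⟨e, he⟩

theorem stmt_14 (p : ℕ) (hp : p.Prime) (G : Type) [Group G] [Fintype G]
    (hG : Nat.card G = p ^ 3) (hna : ∃ x y : G, x * y ≠ y * x)
    (Gs : Fin 3 → Subgroup G) :
    ∃ As : Fin 3 → AddSubgroup (ZMod (p ^ 2) × ZMod p),
      ∀ S : Finset (Fin 3), S.Nonempty →
        (⨅ i ∈ S, Gs i).index = (⨅ i ∈ S, As i).index := by
  obtain ⟨g, hg, hgM⟩ := exists_ne_one_mem_of_index_eq_prime hp three_ne_zero hG hna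
  obtain ⟨e, he⟩ : ∃ e : Subgroup G → Fin 4, ∀ H : Subgroup G, Nat.card H = p ^ (e H : ℕ) :=
    exists_log_card hp hG
  have hle {H K : Subgroup G} (hHK : H ≤ K) : e H ≤ e K := by
    have := Subgroup.card_le_of_le hHK
    rw [he, he] at this
    exact (Nat.pow_le_pow_iff_right hp.one_lt).1 this
  have heq {H K : Subgroup G} (hHK : H ≤ K) (h : e H = e K) : H = K :=
    Subgroup.eq_of_le_of_card_ge hHK (by rw [he, he, h])
  have htop {H : Subgroup G} (h : e H = 3) : H = ⊤ := by
    apply Subgroup.eq_top_of_card_eq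
    rw [he, hG, h]; rfl
  have hmem {H : Subgroup G} (h2 : 2 ≤ e H) : g ∈ H := by
    rcases (by grind : e H = 2 ∨ e H = 3) with h' | h'
    · apply hgM
      have h3 := H.card_mul_index
      rw [he, hG, h', pow_succ] at h3
      exact Nat.eq_of_mul_eq_mul_left (pow_pos hp.pos 2) h3
    · simp [htop h']
  have hpos {H : Subgroup G} (hH : g ∈ H) : 1 ≤ e H := by
    by_contra! h0
    have h0 : e H = 0 := by grind
    have h1 := he H
    rw [h0] at h1
    have hbot : H = ⊥ := Subgroup.card_eq_one.1 (by simpa using h1)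
    exact hg (by simpa [hbot] using hH)
  have hmeet (H K : Subgroup G) : MeetRank (e H) (e K) (e (H ⊓ K)) :=
    ⟨hle inf_le_left, hle inf_le_right, fun h => by rw [htop h, top_inf_eq],
      fun h => by rw [htop h, inf_top_eq], fun h k => hpos ⟨hmem h.ge, hmem k.ge⟩⟩
  have hsame {H K : Subgroup G} (h1 : e (H ⊓ K) = e H) (h2 : e (H ⊓ K) = e K) : H = K :=
    (heq inf_le_left h1).symm.trans (heq inf_le_right h2)
  have htriple (H K L : Subgroup G) :
      e (H ⊓ K ⊓ L) = min (e (H ⊓ K)) (min (e (H ⊓ L)) (e (K ⊓ L))) := by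
    have hx := hle (inf_le_left : H ⊓ K ⊓ L ≤ H ⊓ K)
    have hy := hle (inf_le_inf_right L inf_le_left : H ⊓ K ⊓ L ≤ H ⊓ L)
    have hz := hle (inf_le_inf_right L inf_le_right : H ⊓ K ⊓ L ≤ K ⊓ L)
    have hsub {A B C : Subgroup G} (h1 : e (A ⊓ B) = e A) (h2 : e (A ⊓ C) = e A) :
        A ⊓ B ⊓ C = A := by
      rw [heq inf_le_left h1, heq inf_le_left h2]
    have h1 : e (H ⊓ K) = e H → e (H ⊓ L) = e H → e (H ⊓ K ⊓ L) = e H :=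
      fun h1 h2 => by rw [hsub h1 h2]
    have h2 : e (H ⊓ K) = e K → e (K ⊓ L) = e K → e (H ⊓ K ⊓ L) = e K :=
      fun h1 h2 => by rw [inf_comm H, hsub (inf_comm H K ▸ h1) h2]
    have h3 : e (H ⊓ L) = e L → e (K ⊓ L) = e L → e (H ⊓ K ⊓ L) = e L :=
      fun h1 h2 => by
        rw [inf_comm, ← inf_assoc, hsub (inf_comm H L ▸ h1) (inf_comm K L ▸ h2)]
    have h4 : e H = 3 → e (H ⊓ K ⊓ L) = e (K ⊓ L) := fun h => by rw [htop h, top_inf_eq]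
    have h5 : e K = 3 → e (H ⊓ K ⊓ L) = e (H ⊓ L) := fun h => by rw [htop h, inf_top_eq]
    have h6 : e L = 3 → e (H ⊓ K ⊓ L) = e (H ⊓ K) := fun h => by rw [htop h, inf_top_eq]
    have h7 : 2 ≤ e H → 2 ≤ e K → 2 ≤ e L → 1 ≤ e (H ⊓ K ⊓ L) :=
      fun h1 h2 h3 => hpos ⟨⟨hmem h1, hmem h2⟩, hmem h3⟩
    have h8 := hmeet H K
    have h9 := hmeet H L
    have h10 := hmeet K L
    unfold MeetRank at h8 h9 h10
    generalize e (H ⊓ K ⊓ L) = t, e (H ⊓ K) = x, e (H ⊓ L) = y, e (K ⊓ L) = z, e H = a,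
      e K = b, e L = c at *
    clear * - hx hy hz h1 h2 h3 h4 h5 h6 h7 h8 h9 h10
    grind (splits := 30)
  obtain ⟨f, hf, hcard⟩ := exists_model_subgroups p hp
  obtain ⟨i, hi, j, hj, hij, k, hk, hik, hjk, hijk⟩ := exists_model_of_ranks _ _ _
    (hmeet (Gs 0) (Gs 1)) _ _ (hmeet (Gs 0) (Gs 2)) _ (hmeet (Gs 1) (Gs 2))
    (fun h1 h2 => by rw [hsame h1 h2])
    (fun h1 h2 => by rw [hsame h1 h2, inf_comm])
    (fun h1 h2 => by rw [hsame h1 h2])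
  rw [← htriple] at hijk
  have hindex {H : Subgroup G} {m : Fin 8} (h : modelRank m = e H) : H.index = (f m).index := by
    have h1 := H.card_mul_index
    have h2 := (f m).card_mul_index
    rw [he, hG] at h1
    rw [hcard, h, Nat.card_prod, Nat.card_zmod, Nat.card_zmod, ← pow_succ, ← h1] at h2
    exact (Nat.eq_of_mul_eq_mul_left (pow_pos hp.pos _) h2).symm
  refine ⟨![f i, f j, f k], fun S hS => ?_⟩
  have hS' : S = {0} ∨ S = {1} ∨ S = {2} ∨ S = {0, 1} ∨ S = {0, 2} ∨ S = {1, 2} ∨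
      S = {0, 1, 2} := by
    revert S
    decide
  rcases hS' with rfl | rfl | rfl | rfl | rfl | rfl | rfl <;>
    simp only [Finset.iInf_insert, Finset.iInf_singleton, ← inf_assoc, Matrix.cons_val] <;>
    (try simp only [hf]) <;>
    apply hindex <;> assumption
end
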